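/- arXiv:2006.08909 — 2 statements merged into one kernel-verified Lean document; each statement's English description precedes it below -/
import Mathlib

section
/- Let h_n be the n-th Hankel determinant of the coefficient sequence of B(x) = 1 + x·r(x), and g_n the n-th Hankel determinant of the sequence (r_1, r_2, r_3, ...). Then h_0 = h_1 = 1, and for every n ≥ 2, if k ≥ 0 is the unique integer with 2^k < n ≤ 2^{k+1} and m = 2^{k+1} - n + 1, then h_n = (-1)^{n-1} · (h_m - g_{m-1}). Moreover, for every n ≥ 3, sign(h_n) = -g_{n-1}, where sign(y) = 1 if y ≥ 0 and sign(y) = -1 if y < 0. -/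
/-- The `n`-th Hankel determinant of the sequence `a`: the determinant of the
`n × n` matrix whose `(i,j)` entry is `a (i + j)` (with `H_0 = 1`). -/
def hankel (a : ℕ → ℤ) (n : ℕ) : ℤ :=
  Matrix.det (Matrix.of fun i j : Fin n => a (i.1 + j.1))

open scoped Classical in
/-- The Rueppel sequence: `r n = 1` if `n = 2^m - 1` for some `m`, else `0`. -/
noncomputable def ruep (n : ℕ) : ℤ := if ∃ m : ℕ, n = 2 ^ m - 1 then 1 else 0

/-- Hankel determinants of the shifted Rueppel sequence `(r_{n+1})`. -/
noncomputable def g (n : ℕ) : ℤ := hankel (fun i => ruep (i + 1)) n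

/-- Coefficient sequence of `B(x) = 1 + x·r(x)`. -/
noncomputable def bseq : ℕ → ℤ
  | 0 => 1
  | (n+1) => ruep n

/-- Hankel determinants of the coefficient sequence of `1 + x·r(x)`. -/
noncomputable def h (n : ℕ) : ℤ := hankel bseq n

/-- `sign y = 1` if `y ≥ 0`, and `-1` if `y < 0`. -/
def isign (y : ℤ) : ℤ := if 0 ≤ y then 1 else -1

open Finset Matrix

/-- The determinant of a matrix vanishing below the antidiagonal, with ones on it. -/
theorem det_of_antitriangular (n : ℕ) (M : Matrix (Fin n) (Fin n) ℤ)
    (h_one : ∀ i j : Fin n, i.1 + j.1 + 1 = n → M i j = 1)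
    (h_zero : ∀ i j : Fin n, n < i.1 + j.1 + 1 → M i j = 0) :
    M.det = (-1) ^ ∑ i ∈ range n, i := by
  induction n with
  | zero => simp
  | succ n ih =>
    rw [det_succ_row M (Fin.last n), Finset.sum_eq_single 0]
    · rw [ih, h_one _ _ (by simp), sum_range_succ]
      · simp [pow_add, mul_comm]
      · intro i j hij
        apply h_one
        simp
        omega
      · intro i j hij
        apply h_zero
        simp
        omega
    · intro j _ hj
      have hj' : j.1 ≠ 0 := fun hh => hj (Fin.ext hh)
      rw [h_zero _ _ (by simp only [Fin.val_last]; omega)]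
      simp
    · simp

theorem neg_one_pow_sum_range_odd (d : ℕ) :
    (-1 : ℤ) ^ ∑ i ∈ range (2 * d + 1), i = (-1) ^ d := by
  have hsum : ∑ i ∈ range (2 * d + 1), i = (2 * d + 1) * d := by
    have := sum_range_id_mul_two (2 * d + 1)
    simp only [Nat.add_sub_cancel] at this
    nlinarith
  rw [hsum, pow_mul, Odd.neg_one_pow ⟨d, rfl⟩]

/-- The coefficient sequence of `t + x·r(x)`. -/
noncomputable def cornerSeq (t : ℤ) : ℕ → ℤ
  | 0 => t
  | n + 1 => ruep n

theorem bseq_eq_cornerSeq : bseq = cornerSeq 1 := by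
  funext n
  cases n <;> rfl

theorem cornerSeq_two_pow (t : ℤ) (l : ℕ) : cornerSeq t (2 ^ l) = 1 := by
  obtain ⟨j, hj⟩ := Nat.exists_eq_add_one_of_ne_zero (pow_ne_zero l (two_ne_zero (α := ℕ)))
  rw [hj]
  exact if_pos ⟨l, by omega⟩

theorem cornerSeq_eq_zero (t : ℤ) {k j : ℕ} (h₁ : 2 ^ k < j) (h₂ : j < 2 ^ (k + 1)) :
    cornerSeq t j = 0 := by
  obtain ⟨i, rfl⟩ := Nat.exists_eq_add_one_of_ne_zero (Nat.ne_zero_of_lt h₁)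
  refine if_neg ?_
  rintro ⟨l, hl⟩
  have hpos : 0 < 2 ^ l := by positivity
  have hl' : i + 1 = 2 ^ l := by omega
  rw [hl'] at h₁ h₂
  have h₃ := (Nat.pow_lt_pow_iff_right one_lt_two).1 h₁
  have h₄ := (Nat.pow_lt_pow_iff_right one_lt_two).1 h₂
  omega

theorem cornerSeq_of_pos (t u : ℤ) {j : ℕ} (hj : 0 < j) : cornerSeq t j = cornerSeq u j := by
  obtain ⟨i, rfl⟩ := Nat.exists_eq_add_one_of_ne_zero hj.ne'
  rfl

theorem hankel_cornerSeq_succ (t : ℤ) (n : ℕ) :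
    hankel (cornerSeq t) (n + 1) = hankel (cornerSeq 0) (n + 1) + t * g n := by
  have hsub (u : ℤ) (j : Fin (n + 1)) :
      ((Matrix.of fun i j : Fin (n + 1) => cornerSeq u (i.1 + j.1)).submatrix Fin.succ
        j.succAbove) =
      ((Matrix.of fun i j : Fin (n + 1) => cornerSeq 0 (i.1 + j.1)).submatrix Fin.succ
        j.succAbove) := by
    ext a b
    exact cornerSeq_of_pos _ _ (by simp)
  have hg : g n = ((Matrix.of fun i j : Fin (n + 1) => cornerSeq 0 (i.1 + j.1)).submatrix Fin.succ
      (Fin.succAbove 0)).det := by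
    unfold g hankel
    congr 1
    ext a b
    simp only [of_apply, submatrix_apply, Fin.succAbove_zero, Fin.val_succ]
    rw [show a.1 + 1 + (b.1 + 1) = (a.1 + b.1 + 1) + 1 by ring]
    rfl
  unfold hankel
  rw [det_succ_row_zero, det_succ_row_zero, Fin.sum_univ_succ, Fin.sum_univ_succ]
  simp only [hsub t, ← hg]
  have h0 : cornerSeq t 0 = t := rfl
  have h0' : cornerSeq 0 0 = 0 := rfl
  have hpos (x : Fin n) : cornerSeq t (x.1 + 1) = cornerSeq 0 (x.1 + 1) := rfl
  simp [h0, h0', hpos]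
  ring

theorem hankel_cornerSeq_reflect (t : ℤ) {k d m : ℕ} (hm : 0 < m) (hmd : m + d = 2 ^ k) :
    hankel (cornerSeq t) (m + (2 * d + 1)) = (-1) ^ d * hankel (cornerSeq (t - 1)) m := by
  have hpow : 2 ^ (k + 1) = 2 * m + 2 * d := by rw [pow_succ]; omega
  have hpow' : 2 ^ (k + 2) = 4 * m + 4 * d := by rw [pow_succ, hpow]; omega
  have c_mid : cornerSeq t (m + d) = 1 := hmd ▸ cornerSeq_two_pow t k
  have c_top : cornerSeq t (2 * m + 2 * d) = 1 := hpow ▸ cornerSeq_two_pow t (k + 1)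
  have c_low {j : ℕ} (h₁ : m + d < j) (h₂ : j < 2 * m + 2 * d) : cornerSeq t j = 0 :=
    cornerSeq_eq_zero t (k := k) (by omega) (by omega)
  have c_high {j : ℕ} (h₁ : 2 * m + 2 * d < j) (h₂ : j < 4 * m + 4 * d) : cornerSeq t j = 0 :=
    cornerSeq_eq_zero t (k := k + 1) (by omega) (by rw [hpow']; omega)
  let A : Matrix (Fin m) (Fin m) ℤ := of fun i j => cornerSeq t (i.1 + j.1)
  let B : Matrix (Fin m) (Fin (2 * d + 1)) ℤ := of fun i q => cornerSeq t (i.1 + (m + q.1))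
  let C : Matrix (Fin (2 * d + 1)) (Fin m) ℤ := of fun p j => cornerSeq t (m + p.1 + j.1)
  let D : Matrix (Fin (2 * d + 1)) (Fin (2 * d + 1)) ℤ :=
    of fun p q => cornerSeq t (m + p.1 + (m + q.1))
  let X : Matrix (Fin (2 * d + 1)) (Fin m) ℤ :=
    of fun q i => if q.1 < d then 0 else cornerSeq t (i.1 + m + 2 * d - q.1)
  have hD : D.det = (-1) ^ d := by
    rw [det_of_antitriangular, neg_one_pow_sum_range_odd]
    · intro p q hpq
      simp only [D, of_apply]
      rw [show m + p.1 + (m + q.1) = 2 * m + 2 * d by omega, c_top]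
    · intro p q hpq
      exact c_high (by omega) (by omega)
  have hDX : D * X = C := by
    ext p i
    simp only [mul_apply, D, X, C, of_apply]
    rw [Finset.sum_eq_single ⟨2 * d - p.1, by omega⟩]
    · dsimp only
      rw [show m + p.1 + (m + (2 * d - p.1)) = 2 * m + 2 * d by omega, c_top, one_mul]
      split_ifs with hp
      · exact (c_low (by omega) (by omega)).symm
      · congr 1
        omega
    · intro q _ hq
      have hq' : q.1 ≠ 2 * d - p.1 := fun hh => hq (Fin.ext hh)
      split_ifs with hqd
      · simp
      · rcases lt_or_ge (m + p.1 + (m + q.1)) (2 * m + 2 * d) with hlt | hge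
        · rw [c_low (by omega) hlt, zero_mul]
        · rw [c_high (by omega) (by omega), zero_mul]
    · simp
  have hABX : A - B * X = of fun i j : Fin m => cornerSeq (t - 1) (i.1 + j.1) := by
    ext i j
    simp only [Matrix.sub_apply, mul_apply, A, B, X, of_apply]
    rw [Finset.sum_eq_single ⟨d, by omega⟩]
    · dsimp only
      rw [if_neg (lt_irrefl d)]
      by_cases hi : i.1 = 0
      · by_cases hj : j.1 = 0
        · rw [hi, hj, show 0 + m + 2 * d - d = m + d by omega, zero_add, zero_add, c_mid]
          simp [cornerSeq]
        · rw [c_low (j := j.1 + m + 2 * d - d) (by omega) (by omega), mul_zero, sub_zero]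
          exact cornerSeq_of_pos _ _ (by omega)
      · rw [c_low (j := i.1 + (m + d)) (by omega) (by omega), zero_mul, sub_zero]
        exact cornerSeq_of_pos _ _ (by omega)
    · intro q _ hq
      have hq' : q.1 ≠ d := fun hh => hq (Fin.ext hh)
      split_ifs with hqd
      · simp
      · rw [c_low (by omega) (by omega), zero_mul]
    · simp
  have hblocks : (of fun i j : Fin (m + (2 * d + 1)) => cornerSeq t (i.1 + j.1)).submatrix
      finSumFinEquiv finSumFinEquiv = fromBlocks A B C D := by
    ext (i | i) (j | j) <;> simp [A, B, C, D]
  have hmul : fromBlocks A B C D * fromBlocks 1 0 (-X) 1 = fromBlocks (A - B * X) B 0 D := by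
    simp [fromBlocks_multiply, hDX, sub_eq_add_neg]
  have hdet := congrArg det hmul
  rw [det_mul, det_fromBlocks_zero₁₂, det_fromBlocks_zero₂₁, det_one, det_one, hD, hABX] at hdet
  unfold hankel
  rw [← det_submatrix_equiv_self finSumFinEquiv, hblocks]
  linear_combination hdet

theorem hankel_cornerSeq_one (t : ℤ) : hankel (cornerSeq t) 1 = t := by
  simp [hankel, cornerSeq]

theorem h_eq (n : ℕ) : h n = hankel (cornerSeq 1) n := by rw [h, bseq_eq_cornerSeq]

theorem hankel_cornerSeq_zero_succ (n : ℕ) :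
    hankel (cornerSeq 0) (n + 1) = h (n + 1) - g n := by
  rw [h_eq, hankel_cornerSeq_succ 1]
  ring

theorem h_reflect {k d m : ℕ} (hmd : m + 1 + d = 2 ^ k) :
    h (m + 1 + (2 * d + 1)) = (-1) ^ d * (h (m + 1) - g m) := by
  rw [h_eq, hankel_cornerSeq_reflect 1 m.succ_pos hmd, sub_self, hankel_cornerSeq_zero_succ]

theorem g_reflect {k d m : ℕ} (hmd : m + 1 + d = 2 ^ k) :
    g (m + 1 + 2 * d) = (-1) ^ d * g m := by
  have h₁ := hankel_cornerSeq_reflect 1 m.succ_pos hmd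
  have h₂ := hankel_cornerSeq_reflect 2 m.succ_pos hmd
  rw [← add_assoc, hankel_cornerSeq_succ] at h₁ h₂
  have h₃ := hankel_cornerSeq_succ (2 - 1) m
  rw [sub_self] at h₁
  linear_combination h₂ - h₁ + (-1) ^ d * h₃

theorem g_zero : g 0 = 1 := by simp [g, hankel]

/-- Every `n ≥ 2` is the reflection of some smaller index through a power of two. -/
theorem exists_reflect {n : ℕ} (hn : 2 ≤ n) :
    ∃ k d m : ℕ, m + 1 + d = 2 ^ k ∧ n = m + 1 + (2 * d + 1) := by
  have h₁ : 2 ^ Nat.log 2 (n - 1) ≤ n - 1 := Nat.pow_log_le_self 2 (by omega)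
  have h₂ : n - 1 < 2 ^ (Nat.log 2 (n - 1) + 1) := Nat.lt_pow_succ_log_self one_lt_two _
  rw [pow_succ] at h₂
  exact ⟨Nat.log 2 (n - 1), n - 2 ^ Nat.log 2 (n - 1) - 1, 2 * 2 ^ Nat.log 2 (n - 1) - n,
    by omega, by omega⟩

theorem exists_h_eq_mul_g (n : ℕ) :
    ∃ c : ℤ, h (n + 1) = c * g n ∧ (g n = 1 ∨ g n = -1) ∧ (1 ≤ n → c ≤ 0) ∧
      (n = 0 → c = 1) ∧ (2 ≤ n → c = 0 → g n = -1) := by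
  induction n using Nat.strong_induction_on with
  | _ n ih =>
    rcases Nat.eq_zero_or_pos n with rfl | hn
    · exact ⟨1, by rw [h_eq, hankel_cornerSeq_one, g_zero, mul_one], Or.inl g_zero, by omega,
        fun _ => rfl, by omega⟩
    obtain ⟨k, d, m, hk, hnm⟩ := exists_reflect (n := n + 1) (by omega)
    obtain rfl : n = m + 1 + 2 * d := by omega
    obtain ⟨c, hc, hg, hc₁, hc₀, -⟩ := ih m (by omega)
    have hgr := g_reflect hk
    refine ⟨c - 1, ?_, ?_, fun _ => ?_, by omega, fun h2 h_zero => ?_⟩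
    · rw [hgr, add_assoc, h_reflect hk, hc]
      ring
    · rw [hgr]
      rcases neg_one_pow_eq_or ℤ d with hd | hd <;> rcases hg with hg | hg <;> simp [hd, hg]
    · rcases Nat.eq_zero_or_pos m with hm | hm
      · rw [hc₀ hm, sub_self]
      · linarith [hc₁ hm]
    · have hm : m = 0 := by
        by_contra hm
        linarith [hc₁ (Nat.pos_of_ne_zero hm)]
      subst hm
      have hodd : Odd d := by
        cases k with
        | zero => omega
        | succ k => exact ⟨2 ^ k - 1, by rw [pow_succ] at hk; omega⟩
      rw [hgr, g_zero, hodd.neg_one_pow, mul_one]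

theorem stmt17 :
    h 0 = 1 ∧ h 1 = 1 ∧
    (∀ n k : ℕ, 2 ≤ n → 2 ^ k < n → n ≤ 2 ^ (k + 1) →
      h n = (-1 : ℤ) ^ (n - 1) *
        (h (2 ^ (k + 1) - n + 1) - g (2 ^ (k + 1) - n + 1 - 1))) ∧
    (∀ n : ℕ, 3 ≤ n → isign (h n) = -g (n - 1)) := by
  refine ⟨by simp [h, hankel], by rw [h_eq, hankel_cornerSeq_one], ?_, ?_⟩
  · intro n k hn h₁ h₂
    rw [pow_succ] at h₂
    obtain ⟨d, rfl⟩ : ∃ d, n = 2 ^ k + d + 1 := ⟨n - 2 ^ k - 1, by omega⟩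
    obtain ⟨m, hm⟩ : ∃ m, m + 1 + d = 2 ^ k := ⟨2 ^ k - d - 1, by omega⟩
    have hh := h_reflect hm
    rw [show 2 ^ (k + 1) - (2 ^ k + d + 1) + 1 = m + 1 by rw [pow_succ]; omega,
      show 2 ^ k + d + 1 = m + 1 + (2 * d + 1) by omega, hh, Nat.add_sub_cancel,
      show m + 1 + (2 * d + 1) - 1 = 2 ^ k + d by omega]
    cases k with
    | zero =>
      obtain ⟨rfl, rfl⟩ : m = 0 ∧ d = 0 := by omega
      simp [h_eq, hankel_cornerSeq_one, g_zero]
    | succ k => rw [pow_add, Even.neg_one_pow (n := 2 ^ (k + 1)) ⟨2 ^ k, by ring⟩, one_mul]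
  · intro n hn
    obtain ⟨n, rfl⟩ := Nat.exists_eq_add_one_of_ne_zero (by omega : n ≠ 0)
    obtain ⟨c, hc, hg, hc₁, -, hc₂⟩ := exists_h_eq_mul_g n
    have hc₁ := hc₁ (by omega)
    have hc₂ := hc₂ (by omega)
    rw [hc, Nat.add_sub_cancel, isign]
    rcases hg with hg | hg
    · have hne : c ≠ 0 := fun h_zero => by simp [hg] at hc₂; exact hc₂ h_zero
      rw [hg, if_neg (by omega)]
    · rw [hg, if_pos (by omega), neg_neg]
end

section
/- (Barry's Conjecture 11.) Let h_n be the n-th Hankel determinant of the coefficient sequence of B(x) = 1 + x·r(x). Then |h_0| = |h_1| = 1, |h_{2^{k+1}}| = 0 for all k ≥ 0, |h_n| = |h_{2^{k+1} - n + 1}| + 1 whenever 2^k < n < 2^{k+1}, and consequently |h_{n+1}| = s_n - 2 for every n ≥ 1. -/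
/-- The sequence `j`: `j 0 = 0`, `j (2k) = j k`, `j (2k+1) = (-1)^k`. -/
def j : ℕ → ℤ
  | 0 => 0
  | (n+1) =>
      if (n+1) % 2 = 1 then (-1 : ℤ) ^ ((n+1)/2)
      else j ((n+1)/2)
decreasing_by omega

/-- `s n = 1 + ∑_{k=0}^{n} j k`. -/
def s (n : ℕ) : ℤ := 1 + ∑ k ∈ Finset.range (n+1), j k

/-- Hankel determinant reduction: if `a` equals `1` at `m + q` and `2 (m + q)` and vanishes at the
other indices between `m + q + 1` and `2 (m + 2 q)`, then peeling off the antidiagonal of ones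
replaces `a 0` by `a 0 - 1` and the order `m + 2 q + 1` by `m`, up to sign. -/
lemma abs_hankel_peel (a : ℕ → ℤ) (m q : ℕ) (hm : 0 < m) (h1 : a (m + q) = 1)
    (h2 : a (2 * (m + q)) = 1)
    (h0 : ∀ v, m + q < v → v ≤ 2 * (m + 2 * q) → v ≠ 2 * (m + q) → a v = 0) :
    |hankel a (m + 2 * q + 1)| =
      |hankel (fun k => if k = 0 then a 0 - 1 else a k) m| := by
  let f : Fin q ⊕ ((Fin m ⊕ Unit) ⊕ Fin q) → Fin (m + 2 * q + 1) := fun x =>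
    match x with
    | .inl u => ⟨m + q + 1 + u, by omega⟩
    | .inr (.inl (.inl i)) => ⟨i, by omega⟩
    | .inr (.inl (.inr _)) => ⟨m + q, by omega⟩
    | .inr (.inr u) => ⟨m + q - 1 - u, by omega⟩
  have hf : Function.Injective f := by
    rintro (u | (i | u) | u) (v | (i' | v) | v) huv <;>
      simp only [f, Fin.mk.injEq] at huv <;>
      first
        | rfl
        | (exfalso; omega)
        | (congr; omega)
  have hcard : Fintype.card (Fin q ⊕ ((Fin m ⊕ Unit) ⊕ Fin q)) =
      Fintype.card (Fin (m + 2 * q + 1)) := by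
    simp only [Fintype.card_sum, Fintype.card_fin, Fintype.card_unit]
    omega
  let e : Fin q ⊕ ((Fin m ⊕ Unit) ⊕ Fin q) ≃ Fin (m + 2 * q + 1) :=
    Equiv.ofBijective f ((Fintype.bijective_iff_injective_and_card f).2 ⟨hf, hcard⟩)
  let w : Fin q ⊕ ((Fin m ⊕ Unit) ⊕ Fin q) ≃ Fin q ⊕ ((Fin m ⊕ Unit) ⊕ Fin q) :=
    { toFun := fun x => match x with
        | .inl u => .inr (.inr u)
        | .inr (.inl x) => .inr (.inl x)
        | .inr (.inr u) => .inl u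
      invFun := fun x => match x with
        | .inl u => .inr (.inr u)
        | .inr (.inl x) => .inr (.inl x)
        | .inr (.inr u) => .inl u
      left_inv := by rintro (u | u | u) <;> rfl
      right_inv := by rintro (u | u | u) <;> rfl }
  let X : Matrix (Fin m ⊕ Unit) (Fin m ⊕ Unit) ℤ := Matrix.fromBlocks
    (Matrix.of fun i j : Fin m => a (i.1 + j.1))
    (Matrix.of fun i _ => if i.1 = 0 then 1 else 0)
    (Matrix.of fun _ j => if j.1 = 0 then 1 else 0) 1
  let M : Matrix (Fin (m + 2 * q + 1)) (Fin (m + 2 * q + 1)) ℤ :=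
    Matrix.of fun i j => a (i.1 + j.1)
  have hM : M.submatrix e (w.trans e) = Matrix.fromBlocks 1 0
      (Matrix.of fun x y => M (f (.inr x)) (f (.inr (.inr y))))
      (Matrix.fromBlocks X 0
        (Matrix.of fun x y => M (f (.inr (.inr x))) (f (.inr (.inl y)))) 1) := by
    have he : ∀ x, e x = f x := fun _ => rfl
    ext (u | (i | u) | u) (v | (i' | v) | v) <;>
      simp only [Matrix.submatrix_apply, Equiv.trans_apply, he, w, Equiv.coe_fn_mk, f, M, X,
        Matrix.of_apply, Matrix.fromBlocks_apply₁₁, Matrix.fromBlocks_apply₁₂,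
        Matrix.fromBlocks_apply₂₁, Matrix.fromBlocks_apply₂₂, Matrix.one_apply,
        Matrix.zero_apply]
    · split_ifs with huv
      · subst huv
        rw [← h2]; congr 1; omega
      · exact h0 _ (by omega) (by omega) (fun hc => huv (Fin.ext (by omega)))
    · exact h0 _ (by omega) (by omega) (by omega)
    · exact h0 _ (by omega) (by omega) (by omega)
    · exact h0 _ (by omega) (by omega) (by omega)
    · split_ifs with hi
      · rw [hi, zero_add, h1]
      · exact h0 _ (by omega) (by omega) (by omega)
    · exact h0 _ (by omega) (by omega) (by omega)
    · split_ifs with hi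
      · rw [hi, add_zero, h1]
      · exact h0 _ (by omega) (by omega) (by omega)
    · simp only [if_true]
      rw [← h2]; congr 1; omega
    · exact h0 _ (by omega) (by omega) (by omega)
    · split_ifs with huv
      · subst huv
        rw [← h2]; congr 1; omega
      · exact h0 _ (by omega) (by omega) (fun hc => huv (Fin.ext (by omega)))
  have hdet : |M.det| = |X.det| := by
    rw [← Matrix.abs_det_submatrix_equiv_equiv e (w.trans e) M, hM,
      Matrix.det_fromBlocks_zero₁₂, Matrix.det_fromBlocks_zero₁₂, Matrix.det_one,
      one_mul, mul_one]
  change |M.det| = _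
  rw [hdet, Matrix.det_fromBlocks_one₂₂, hankel]
  congr 2
  ext i i'
  simp only [Matrix.sub_apply, Matrix.mul_apply, Matrix.of_apply, Finset.univ_unique,
    Finset.sum_singleton]
  by_cases hi : i.1 = 0 <;> by_cases hi' : i'.1 = 0 <;> simp [hi, hi']

open scoped Classical in
/-- The indicator sequence of the powers of two, with value `t` at `0`. -/
noncomputable def powTwoSeq (t : ℤ) (n : ℕ) : ℤ :=
  if n = 0 then t else if ∃ m : ℕ, n = 2 ^ m then 1 else 0

lemma powTwoSeq_two_pow (t : ℤ) (k : ℕ) : powTwoSeq t (2 ^ k) = 1 := by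
  simp [powTwoSeq]

lemma powTwoSeq_eq_zero (t : ℤ) {k n : ℕ} (h1 : 2 ^ k < n) (h2 : n < 2 ^ (k + 1)) :
    powTwoSeq t n = 0 := by
  have hn : n ≠ 0 := by omega
  rw [powTwoSeq, if_neg hn, if_neg]
  rintro ⟨m, rfl⟩
  have := (Nat.pow_lt_pow_iff_right (by norm_num)).1 h1
  have := (Nat.pow_lt_pow_iff_right (by norm_num)).1 h2
  omega

lemma bseq_eq_powTwoSeq : bseq = powTwoSeq 1 := by
  funext n
  cases n with
  | zero => simp [bseq, powTwoSeq]
  | succ n =>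
    simp only [bseq, ruep, powTwoSeq, Nat.succ_ne_zero, if_false]
    congr 1
    refine propext (exists_congr fun m => ?_)
    have := Nat.one_le_two_pow (n := m)
    omega

lemma j_two_mul (k : ℕ) : j (2 * k) = j k := by
  rcases k with _ | k
  · rfl
  · rw [show 2 * (k + 1) = (2 * k + 1) + 1 by ring, j, if_neg (by omega)]
    congr 1
    omega

lemma j_two_mul_add_one (k : ℕ) : j (2 * k + 1) = (-1) ^ k := by
  rw [j, if_pos (by omega)]
  congr 1
  omega

lemma j_two_pow (k : ℕ) : j (2 ^ k) = 1 := by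
  induction k with
  | zero => simpa using j_two_mul_add_one 0
  | succ k ih => rw [pow_succ', j_two_mul, ih]

lemma j_add_j_eq_zero (k x y : ℕ) (hxy : x + y = 2 ^ (k + 1)) (h0 : 0 < x) (hx : x < 2 ^ k) :
    j x + j y = 0 := by
  induction k generalizing x y with
  | zero => simp at hx; omega
  | succ k ih =>
    have hk : 2 ^ (k + 2) = 2 * 2 ^ (k + 1) := pow_succ' 2 (k + 1)
    have hk' : 2 ^ (k + 1) = 2 * 2 ^ k := pow_succ' 2 k
    rw [show k + 1 + 1 = k + 2 from rfl] at hxy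
    obtain ⟨u, rfl | rfl⟩ := Nat.even_or_odd' x
    · obtain ⟨v, rfl⟩ : ∃ v, y = 2 * v := ⟨y / 2, by omega⟩
      rw [j_two_mul, j_two_mul]
      exact ih u v (by omega) (by omega) (by omega)
    · obtain ⟨v, rfl⟩ : ∃ v, y = 2 * v + 1 := ⟨y / 2, by omega⟩
      rw [j_two_mul_add_one, j_two_mul_add_one]
      have huv : Odd (u + v) := ⟨2 ^ k - 1, by have := Nat.one_le_two_pow (n := k); omega⟩
      rcases Nat.even_or_odd u with hu | hu
      · rw [hu.neg_one_pow, ((Nat.odd_add'.1 huv).2 hu).neg_one_pow]; norm_num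
      · rw [hu.neg_one_pow, ((Nat.odd_add.1 huv).1 hu).neg_one_pow]; norm_num

lemma sum_j_reflect (k n : ℕ) (h1 : 2 ^ k ≤ n) (h2 : n < 2 ^ (k + 1)) :
    ∑ i ∈ Finset.range (n + 1), j i = 1 + ∑ i ∈ Finset.range (2 ^ (k + 1) - n), j i := by
  induction n, h1 using Nat.le_induction with
  | base =>
    rw [Finset.sum_range_succ, j_two_pow, show 2 ^ (k + 1) - 2 ^ k = 2 ^ k by rw [pow_succ]; omega]
    ring
  | succ n hn ih =>
    have hk : 2 ^ (k + 1) = 2 * 2 ^ k := pow_succ' 2 k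
    rw [Finset.sum_range_succ, ih (by omega),
      show 2 ^ (k + 1) - n = 2 ^ (k + 1) - (n + 1) + 1 by omega, Finset.sum_range_succ]
    have := j_add_j_eq_zero k (2 ^ (k + 1) - (n + 1)) (n + 1) (by omega) (by omega) (by omega)
    linarith

lemma exists_two_pow_le_lt {n : ℕ} (hn : 0 < n) : ∃ k, 2 ^ k ≤ n ∧ n < 2 ^ (k + 1) :=
  ⟨Nat.log 2 n, Nat.pow_log_le_self 2 hn.ne', Nat.lt_pow_succ_log_self (by norm_num) n⟩

lemma sum_j_nonneg (n : ℕ) : 0 ≤ ∑ i ∈ Finset.range n, j i := by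
  induction n using Nat.strong_induction_on with
  | _ n ih =>
    rcases n with _ | _ | n
    · simp
    · simp [j]
    · obtain ⟨k, h1, h2⟩ := exists_two_pow_le_lt (Nat.succ_pos n)
      rw [sum_j_reflect k (n + 1) h1 h2]
      have := ih (2 ^ (k + 1) - (n + 1)) (by rw [pow_succ]; omega)
      omega

lemma one_le_sum_j {n : ℕ} (hn : 2 ≤ n) : 1 ≤ ∑ i ∈ Finset.range n, j i := by
  obtain ⟨n, rfl⟩ : ∃ l, n = l + 1 := ⟨n - 1, by omega⟩
  obtain ⟨k, h1, h2⟩ := exists_two_pow_le_lt (show 0 < n by omega)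
  rw [sum_j_reflect k n h1 h2]
  have := sum_j_nonneg (2 ^ (k + 1) - n)
  omega

lemma abs_hankel_powTwoSeq (n : ℕ) (t : ℤ) :
    |hankel (powTwoSeq t) (n + 1)| = |t - ∑ i ∈ Finset.range (n + 1), j i| := by
  induction n using Nat.strong_induction_on generalizing t with
  | _ n ih =>
    rcases Nat.eq_zero_or_pos n with rfl | hn
    · simp [hankel, powTwoSeq, j]
    · obtain ⟨k, h1, h2⟩ := exists_two_pow_le_lt hn
      have hk : 2 ^ (k + 1) = 2 * 2 ^ k := pow_succ' 2 k
      have hk' : 2 ^ (k + 2) = 2 * 2 ^ (k + 1) := pow_succ' 2 (k + 1)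
      have hN : 2 ^ (k + 1) - n + (n - 2 ^ k) = 2 ^ k := by omega
      have hpeel := abs_hankel_peel (powTwoSeq t) (2 ^ (k + 1) - n) (n - 2 ^ k) (by omega)
        (by rw [hN, powTwoSeq_two_pow]) (by rw [hN, ← hk, powTwoSeq_two_pow])
        (fun v hv1 hv2 hv3 => by
          rcases lt_or_ge v (2 ^ (k + 1)) with hv | hv
          · exact powTwoSeq_eq_zero t (by omega) hv
          · exact powTwoSeq_eq_zero (k := k + 1) t (by omega)
              (by rw [show k + 1 + 1 = k + 2 from rfl]; omega))
      have hseq : (fun i => if i = 0 then powTwoSeq t 0 - 1 else powTwoSeq t i) =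
          powTwoSeq (t - 1) := by
        funext i
        by_cases hi : i = 0 <;> simp [powTwoSeq, hi]
      rw [hseq, show 2 ^ (k + 1) - n + 2 * (n - 2 ^ k) + 1 = n + 1 by omega] at hpeel
      have hih := ih (2 ^ (k + 1) - n - 1) (by omega) (t - 1)
      rw [show 2 ^ (k + 1) - n - 1 + 1 = 2 ^ (k + 1) - n by omega] at hih
      rw [hpeel, hih, sum_j_reflect k n h1 h2, sub_sub]

lemma abs_h_succ (n : ℕ) : |h (n + 1)| = |1 - ∑ i ∈ Finset.range (n + 1), j i| := by
  rw [h, bseq_eq_powTwoSeq, abs_hankel_powTwoSeq]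

lemma abs_h_of_two_le {n : ℕ} (hn : 2 ≤ n) : |h n| = ∑ i ∈ Finset.range n, j i - 1 := by
  obtain ⟨n, rfl⟩ : ∃ l, n = l + 1 := ⟨n - 1, by omega⟩
  rw [abs_h_succ, abs_sub_comm, abs_of_nonneg]
  have := one_le_sum_j hn
  omega

theorem stmt18 :
    |h 0| = 1 ∧ |h 1| = 1 ∧
    (∀ k : ℕ, |h (2 ^ (k + 1))| = 0) ∧
    (∀ n k : ℕ, 2 ^ k < n → n < 2 ^ (k + 1) →
      |h n| = |h (2 ^ (k + 1) - n + 1)| + 1) ∧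
    (∀ n : ℕ, 1 ≤ n → |h (n + 1)| = s n - 2) := by
  refine ⟨by simp [h, hankel], by simp [abs_h_succ, j], fun k => ?_, fun n k h1 h2 => ?_,
    fun n hn => ?_⟩
  · have hk := Nat.one_le_two_pow (n := k)
    have hk' : 2 ^ (k + 1) = 2 * 2 ^ k := pow_succ' 2 k
    have hsum := sum_j_reflect k (2 ^ (k + 1) - 1) (by omega) (by omega)
    rw [show 2 ^ (k + 1) - 1 + 1 = 2 ^ (k + 1) by omega,
      show 2 ^ (k + 1) - (2 ^ (k + 1) - 1) = 1 by omega] at hsum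
    rw [abs_h_of_two_le (by omega), hsum]
    simp [j]
  · have hk := Nat.one_le_two_pow (n := k)
    have hsum := sum_j_reflect k (n - 1) (by omega) (by omega)
    rw [show n - 1 + 1 = n by omega,
      show 2 ^ (k + 1) - (n - 1) = 2 ^ (k + 1) - n + 1 by omega] at hsum
    rw [abs_h_of_two_le (by omega), abs_h_of_two_le (by omega), hsum]
    ring
  · rw [abs_h_of_two_le (by omega), s]
    ring
end
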